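/- arXiv:1107.4059 — 2 statements merged into one kernel-verified Lean document; each statement's English description precedes it below -/
import Mathlib

section
/- Let α be a partial order, f : ℝ → α an antitone function, and a < b real numbers. Suppose: (i) for every t ∈ [a, b) there exists ε > 0 such that f(s) = f(t) for all s ∈ [t, t + ε); and (ii) no t ∈ (a, b) is a jump point of f. Then f is constant on [a, b). -/
/-- A real number `t` is a jump point of `f : ℝ → α` if for every `ε > 0`,
`f (t - ε) ≠ f t`. -/
def IsJumpPoint {α : Type*} (f : ℝ → α) (t : ℝ) : Prop :=
  ∀ ε : ℝ, 0 < ε → f (t - ε) ≠ f t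

theorem constant_of_right_constant_of_no_jump {α : Type*} [PartialOrder α]
    (f : ℝ → α) (hf : Antitone f) (a b : ℝ) (hab : a < b)
    (hright : ∀ t ∈ Set.Ico a b, ∃ ε : ℝ, 0 < ε ∧ ∀ s ∈ Set.Ico t (t + ε), f s = f t)
    (hnojump : ∀ t ∈ Set.Ioo a b, ¬ IsJumpPoint f t) :
    ∀ t ∈ Set.Ico a b, f t = f a := by
  intro t ht
  set S : Set ℝ := {s | s ∈ Set.Icc a t ∧ f s = f a}
  have haS : a ∈ S := ⟨⟨le_rfl, ht.1⟩, rfl⟩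
  have hbdd : BddAbove S := ⟨t, fun s hs => hs.1.2⟩
  set c := sSup S
  have hac : a ≤ c := le_csSup hbdd haS
  have hct : c ≤ t := csSup_le ⟨a, haS⟩ fun s hs => hs.1.2
  have hcb : c < b := hct.trans_lt ht.2
  have hconst : ∀ s, a ≤ s → s < c → f s = f a := by
    intro s has hsc
    obtain ⟨u, hu, hsu⟩ := exists_lt_of_lt_csSup ⟨a, haS⟩ hsc
    exact le_antisymm (hf has) (hu.2 ▸ hf hsu.le)
  have hc : f c = f a := by
    rcases hac.eq_or_lt with h | h
    · rw [← h]
    · have hjump := hnojump c ⟨h, hcb⟩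
      simp only [IsJumpPoint, not_forall, not_not] at hjump
      obtain ⟨ε, hε, hfε⟩ := hjump
      have hsc : max a (c - ε) < c := max_lt h (by linarith)
      rw [← hconst _ (le_max_left _ _) hsc]
      exact le_antisymm (hf hsc.le) (hfε ▸ hf (le_max_right _ _))
  rcases hct.eq_or_lt with h | h
  · rw [← h, hc]
  · obtain ⟨ε, hε, hfε⟩ := hright c ⟨hac, hcb⟩
    obtain ⟨u, hcu, hu⟩ := exists_between (lt_min h (lt_add_of_pos_right c hε))
    have huS : u ∈ S :=
      ⟨⟨hac.trans hcu.le, (hu.trans_le (min_le_left _ _)).le⟩,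
        (hfε u ⟨hcu.le, hu.trans_le (min_le_right _ _)⟩).trans hc⟩
    exact absurd (le_csSup hbdd huS) hcu.not_ge
end

section
/- Let R be an integral domain with fraction field K, and let x ∈ K be nonzero. Let I : ℝ → FractionalIdeal(R⁰, K) be an antitone function such that: (i) for every t ∈ ℝ there exists ε > 0 with I(s) = I(t) for all s ∈ [t, t + ε); (ii) the set of jump points of I is contained in ℚ and has no accumulation points in ℝ; and (iii) I(λ + 1) = (spanSingleton x) · I(λ) for all λ ∈ ℝ. Let 𝒢 be a family of antitone functions from ℝ to FractionalIdeal(R⁰, K) such that: (a) I(t) ≤ G(t) for every G ∈ 𝒢 and every t; (b) 𝒢 is directed downward, i.e., for all G₁, G₂ ∈ 𝒢 there exists H ∈ 𝒢 with H ≤ G₁ and H ≤ G₂ pointwise; (c) every G ∈ 𝒢 satisfies G(λ + 1) = (spanSingleton x) · G(λ) for all λ ≥ 0; and (d) for every rational number t ≥ 0 there exists G ∈ 𝒢 with G(t) = I(t). Then there exists a single H ∈ 𝒢 such that H(t) = I(t) for all t ≥ 0. -/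
/-- An antitone, right locally constant function attains the value `f t` at a point of `[0, t]`
which is either `0` or a jump point. -/
theorem exists_eq_zero_or_isJumpPoint {α : Type*} [PartialOrder α] {f : ℝ → α} (hf : Antitone f)
    (hright : ∀ t : ℝ, ∃ ε : ℝ, 0 < ε ∧ ∀ s ∈ Set.Ico t (t + ε), f s = f t)
    {t : ℝ} (ht : 0 ≤ t) :
    ∃ s : ℝ, 0 ≤ s ∧ s ≤ t ∧ f s = f t ∧ (s = 0 ∨ IsJumpPoint f s) := by
  set S : Set ℝ := {s | 0 ≤ s ∧ f s = f t}
  have htS : t ∈ S := ⟨ht, rfl⟩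
  have hbdd : BddBelow S := ⟨0, fun s hs => hs.1⟩
  have hm0 : 0 ≤ sInf S := le_csInf ⟨t, htS⟩ fun s hs => hs.1
  obtain ⟨ε, hε, hconst⟩ := hright (sInf S)
  obtain ⟨s, hsS, hs⟩ := exists_lt_of_csInf_lt ⟨t, htS⟩ (lt_add_of_pos_right (sInf S) hε)
  have hval : f (sInf S) = f t := (hconst s ⟨csInf_le hbdd hsS, hs⟩).symm.trans hsS.2
  refine ⟨sInf S, hm0, csInf_le hbdd htS, hval, ?_⟩
  rcases hm0.eq_or_lt with h0 | hpos
  · exact Or.inl h0.symm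
  · refine Or.inr fun δ hδ heq => ?_
    have hlt : max 0 (sInf S - δ) < sInf S := max_lt hpos (sub_lt_self _ hδ)
    have hmem : max 0 (sInf S - δ) ∈ S :=
      ⟨le_max_left _ _, ((hf (le_max_right _ _)).trans (heq.trans hval).le).antisymm
        (hval.ge.trans (hf hlt.le))⟩
    exact (csInf_le hbdd hmem).not_gt hlt

/-- A set without accumulation points meets a compact set in a finite set. -/
theorem Set.finite_inter_of_forall_not_accPt {X : Type*} [TopologicalSpace X] {A C : Set X}
    (hC : IsCompact C) (hA : ∀ y, ¬ AccPt y (Filter.principal A)) : (A ∩ C).Finite := by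
  by_contra hinf
  obtain ⟨y, -, hy⟩ :=
    Set.Infinite.exists_accPt_of_subset_isCompact hinf hC Set.inter_subset_right
  exact hA y (hy.mono (Filter.principal_mono.2 Set.inter_subset_left))

/-- In a family of functions above `f` that is directed downward, finitely many values of `f` that
are each attained by a member of the family are attained simultaneously. -/
theorem exists_mem_forall_eq_of_directed {ι α : Type*} [PartialOrder α] {f : ι → α}
    {𝒢 : Set (ι → α)} (hne : 𝒢.Nonempty) (hle : ∀ G ∈ 𝒢, ∀ t, f t ≤ G t)
    (hdir : ∀ G₁ ∈ 𝒢, ∀ G₂ ∈ 𝒢, ∃ H ∈ 𝒢, (∀ t, H t ≤ G₁ t) ∧ ∀ t, H t ≤ G₂ t)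
    {S : Set ι} (hS : S.Finite) (hatt : ∀ t ∈ S, ∃ G ∈ 𝒢, G t = f t) :
    ∃ H ∈ 𝒢, ∀ t ∈ S, H t = f t := by
  induction S, hS using Set.Finite.induction_on with
  | empty => exact hne.imp fun G hG => ⟨hG, by simp⟩
  | @insert a S _ _ ih =>
    obtain ⟨G₁, hG₁, h₁⟩ := ih fun t ht => hatt t (Set.mem_insert_of_mem a ht)
    obtain ⟨G₂, hG₂, h₂⟩ := hatt a (Set.mem_insert a S)
    obtain ⟨H, hH, hH₁, hH₂⟩ := hdir G₁ hG₁ G₂ hG₂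
    refine ⟨H, hH, fun t ht => le_antisymm ?_ (hle H hH t)⟩
    rcases Set.mem_insert_iff.1 ht with rfl | ht
    · exact (hH₂ t).trans h₂.le
    · exact (hH₁ t).trans (h₁ t ht).le

theorem single_cover_computes {R : Type*} [CommRing R] [IsDomain R]
    (K : Type*) [Field K] [Algebra R K] [IsFractionRing R K]
    (x : K) (hx : x ≠ 0)
    (I : ℝ → FractionalIdeal (nonZeroDivisors R) K)
    (hIanti : Antitone I)
    (hIright : ∀ t : ℝ, ∃ ε : ℝ, 0 < ε ∧ ∀ s ∈ Set.Ico t (t + ε), I s = I t)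
    (hIjump : (∀ t ∈ {t : ℝ | IsJumpPoint I t}, ∃ q : ℚ, (q : ℝ) = t) ∧
      ∀ y : ℝ, ¬ AccPt y (Filter.principal {t : ℝ | IsJumpPoint I t}))
    (hIshift : ∀ l : ℝ,
      I (l + 1) = FractionalIdeal.spanSingleton (nonZeroDivisors R) x * I l)
    (𝒢 : Set (ℝ → FractionalIdeal (nonZeroDivisors R) K))
    (h𝒢anti : ∀ G ∈ 𝒢, Antitone G)
    (hle : ∀ G ∈ 𝒢, ∀ t : ℝ, I t ≤ G t)
    (hdir : ∀ G₁ ∈ 𝒢, ∀ G₂ ∈ 𝒢, ∃ H ∈ 𝒢, (∀ t : ℝ, H t ≤ G₁ t) ∧ ∀ t : ℝ, H t ≤ G₂ t)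
    (h𝒢shift : ∀ G ∈ 𝒢, ∀ l : ℝ, 0 ≤ l →
      G (l + 1) = FractionalIdeal.spanSingleton (nonZeroDivisors R) x * G l)
    (hcompute : ∀ t : ℚ, 0 ≤ t → ∃ G ∈ 𝒢, G (t : ℝ) = I (t : ℝ)) :
    ∃ H ∈ 𝒢, ∀ t : ℝ, 0 ≤ t → H t = I t := by
  set S : Set ℝ := insert 0 ({t | IsJumpPoint I t} ∩ Set.Icc 0 1)
  have hS : S.Finite := (Set.finite_inter_of_forall_not_accPt isCompact_Icc hIjump.2).insert 0
  have hzero : ∃ G ∈ 𝒢, G 0 = I 0 := by simpa using hcompute 0 le_rfl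
  have hatt : ∀ t ∈ S, ∃ G ∈ 𝒢, G t = I t := by
    rintro t (rfl | ⟨hjump, ht, -⟩)
    · exact hzero
    · obtain ⟨q, rfl⟩ := hIjump.1 t hjump
      exact hcompute q (by exact_mod_cast ht)
  obtain ⟨H, hH, hHS⟩ :=
    exists_mem_forall_eq_of_directed (hzero.imp fun _ h => h.1) hle hdir hS hatt
  have hunit : ∀ t : ℝ, 0 ≤ t → t ≤ 1 → H t = I t := by
    intro t ht0 ht1
    obtain ⟨s, hs0, hst, hval, hs⟩ := exists_eq_zero_or_isJumpPoint hIanti hIright ht0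
    have hsS : s ∈ S := hs.imp id fun hjump => ⟨hjump, hs0, hst.trans ht1⟩
    exact ((h𝒢anti H hH hst).trans ((hHS s hsS).trans hval).le).antisymm (hle H hH t)
  have hshift : ∀ (n : ℕ) (t : ℝ), 0 ≤ t → t ≤ 1 → H (t + n) = I (t + n) := by
    intro n t ht0 ht1
    induction n with
    | zero => simpa using hunit t ht0 ht1
    | succ n ih =>
      rw [Nat.cast_succ, ← add_assoc, h𝒢shift H hH _ (by positivity), hIshift, ih]
  refine ⟨H, hH, fun t ht => ?_⟩
  have hfloor := hshift ⌊t⌋₊ (t - ⌊t⌋₊) (sub_nonneg.2 (Nat.floor_le ht))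
    (by linarith [Nat.lt_floor_add_one t])
  rwa [sub_add_cancel] at hfloor
end
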